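/- Fix $\kappa \in (0,4)$ and let $\alpha = e^{i\theta}$ with $\theta \in (0,\pi)$ be the root of $m^2+(2-\kappa)m+1$ with positive imaginary part, and $\beta = \bar{\alpha}$. Then the function $u(\tau) = 1 + \frac{\sqrt{\kappa}}{\alpha-\beta}\left[\frac{e^{\alpha\tau}\mathrm{erfc}\sqrt{\alpha\tau}}{\sqrt{\alpha}} - \frac{e^{\beta\tau}\mathrm{erfc}\sqrt{\beta\tau}}{\sqrt{\beta}}\right]$ is real-valued and satisfies $u'(\tau) > 0$ for all $\tau > 0$. -/

import Mathlib

open Complex MeasureTheory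

/-- The entire extension of the complementary error function. -/
noncomputable def cerfc (w : ℂ) : ℂ :=
  (2 / Real.sqrt Real.pi : ℝ) * ∫ s : ℝ in Set.Ioi (0:ℝ), Complex.exp (-(w + s)^2)

theorem integral_add_comp_neg {f : ℝ → ℂ} (hf : Integrable f) :
    ∫ t : ℝ, (f t + f (-t)) = 2 * ∫ t : ℝ, f t := by
  rw [integral_add hf hf.comp_neg, integral_neg_eq_self, two_mul]

/-- Integrability on the product, needed to swap the Laplace and Gaussian integrals. -/
theorem integrable_laplace_gaussian {b : ℂ} (hb : 0 < b.re) {τ : ℝ} (hτ : 0 < τ) :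
    Integrable (Function.uncurry fun (t s : ℝ) =>
      cexp (-(τ : ℂ) * (t : ℂ) ^ 2) * cexp (-(b - I * t) * s))
      (volume.prod (volume.restrict (Set.Ioi (0 : ℝ)))) := by
  have h1 : Integrable (fun t : ℝ => cexp (-(τ : ℂ) * (t : ℂ) ^ 2)) :=
    integrable_cexp_neg_mul_sq (by simpa using hτ)
  have h2 : Integrable (fun s : ℝ => cexp (-b * s)) (volume.restrict (Set.Ioi (0 : ℝ))) :=
    integrableOn_exp_mul_complex_Ioi (by simpa using hb) 0
  refine (h1.mul_prod h2).mono (Continuous.aestronglyMeasurable ?_) (ae_of_all _ ?_)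
  · simp only [Function.uncurry_def]
    fun_prop
  · rintro ⟨t, s⟩
    simp [Function.uncurry, Complex.norm_exp]

theorem integral_gaussian_div_sub {b : ℂ} (hb : 0 < b.re) {τ : ℝ} (hτ : 0 < τ) :
    ∫ t : ℝ, cexp (-(τ : ℂ) * (t : ℂ) ^ 2) / (b - I * t) =
      (Real.pi / τ : ℂ) ^ (1 / 2 : ℂ) *
        ∫ s : ℝ in Set.Ioi 0, cexp (-b * s) * cexp (-(s : ℂ) ^ 2 / (4 * τ)) := by
  have hswap := integral_integral_swap (integrable_laplace_gaussian hb hτ)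
  have hL : ∀ t : ℝ, ∫ s : ℝ in Set.Ioi 0,
      cexp (-(τ : ℂ) * (t : ℂ) ^ 2) * cexp (-(b - I * t) * s) =
        cexp (-(τ : ℂ) * (t : ℂ) ^ 2) / (b - I * t) := by
    intro t
    rw [integral_const_mul, integral_exp_mul_complex_Ioi (by simpa using hb)]
    simp [div_eq_mul_inv, -neg_sub]
  have hR : ∀ s : ℝ, ∫ t : ℝ, cexp (-(τ : ℂ) * (t : ℂ) ^ 2) * cexp (-(b - I * t) * s) =
      (Real.pi / τ : ℂ) ^ (1 / 2 : ℂ) * (cexp (-b * s) * cexp (-(s : ℂ) ^ 2 / (4 * τ))) := by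
    intro s
    have h := fourierIntegral_gaussian (b := (τ : ℂ)) (by simpa using hτ) s
    calc _ = ∫ t : ℝ, cexp (-b * s) * (cexp (I * s * t) * cexp (-(τ : ℂ) * (t : ℂ) ^ 2)) := by
          congr 1
          ext t
          rw [← Complex.exp_add, ← Complex.exp_add, ← Complex.exp_add]
          ring_nf
      _ = _ := by
          rw [integral_const_mul, h]
          ring_nf
  simp only [hL, hR] at hswap
  rw [hswap, integral_const_mul]

theorem integrable_gaussian_div_sub {b : ℂ} (hb : 0 < b.re) {τ : ℝ} (hτ : 0 < τ) :
    Integrable (fun t : ℝ => cexp (-(τ : ℂ) * (t : ℂ) ^ 2) / (b - I * t)) := by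
  have h := (integrable_laplace_gaussian hb hτ).integral_prod_left
  refine h.congr (ae_of_all _ fun t => ?_)
  simp only [Function.uncurry]
  rw [integral_const_mul, integral_exp_mul_complex_Ioi (by simpa using hb)]
  simp [div_eq_mul_inv, -neg_sub]

theorem add_sq_ne_zero_of_re_pos {b : ℂ} (hb : 0 < b.re) (t : ℝ) : b ^ 2 + (t : ℂ) ^ 2 ≠ 0 := by
  have h1 : b - I * t ≠ 0 := fun h => by
    have := congrArg Complex.re h
    simp at this
    linarith
  have h2 : b + I * t ≠ 0 := fun h => by
    have := congrArg Complex.re h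
    simp at this
    linarith
  have h3 : b ^ 2 + (t : ℂ) ^ 2 = (b - I * t) * (b + I * t) := by
    linear_combination (t : ℂ) ^ 2 * Complex.I_sq
  rw [h3]
  exact mul_ne_zero h1 h2

theorem gaussian_div_sq_add_sq {b : ℂ} (hb : 0 < b.re) (τ t : ℝ) :
    cexp (-(τ : ℂ) * (t : ℂ) ^ 2) / (b ^ 2 + (t : ℂ) ^ 2) =
      (1 / (2 * b)) * (cexp (-(τ : ℂ) * (t : ℂ) ^ 2) / (b - I * t) +
        cexp (-(τ : ℂ) * ((-t : ℝ) : ℂ) ^ 2) / (b - I * (-t : ℝ))) := by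
  have h0 : b ≠ 0 := fun h => by simp [h] at hb
  have h := add_sq_ne_zero_of_re_pos hb t
  have h3 : b ^ 2 + (t : ℂ) ^ 2 = (b - I * t) * (b + I * t) := by
    linear_combination (t : ℂ) ^ 2 * Complex.I_sq
  rw [h3] at h ⊢
  have h1 := left_ne_zero_of_mul h
  have h2 := right_ne_zero_of_mul h
  have h4 : b - I * (-t : ℝ) = b + I * t := by push_cast; ring
  have h5 : (((-t : ℝ)) : ℂ) ^ 2 = (t : ℂ) ^ 2 := by push_cast; ring
  have h6 : 2 * b = (b - I * t) + (b + I * t) := by ring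
  have h7 : (b - I * t) + (b + I * t) ≠ 0 := h6 ▸ mul_ne_zero two_ne_zero h0
  rw [h4, h5, h6]
  generalize b - I * t = p at *
  generalize b + I * t = r at *
  field_simp
  ring

theorem integrable_gaussian_div_sq_add_sq {b : ℂ} (hb : 0 < b.re) {τ : ℝ} (hτ : 0 < τ) :
    Integrable (fun t : ℝ => cexp (-(τ : ℂ) * (t : ℂ) ^ 2) / (b ^ 2 + (t : ℂ) ^ 2)) := by
  simp only [gaussian_div_sq_add_sq hb]
  have h := integrable_gaussian_div_sub hb hτ
  exact (h.add h.comp_neg).const_mul _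

/-- The integral representation of `e^{b²τ} erfc(b√τ) / b`. -/
theorem exp_mul_cerfc_div {b : ℂ} (hb : 0 < b.re) {τ : ℝ} (hτ : 0 < τ) :
    cexp (b ^ 2 * τ) * cerfc ((b ^ 2 * τ) ^ (1 / 2 : ℂ)) / (b ^ 2) ^ (1 / 2 : ℂ) =
      (1 / Real.pi : ℂ) *
        ∫ t : ℝ, cexp (-(τ : ℂ) * (t : ℂ) ^ 2) / (b ^ 2 + (t : ℂ) ^ 2) := by
  have h0 : b ≠ 0 := fun h => by simp [h] at hb
  have hx : 0 < √τ := Real.sqrt_pos.2 hτ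
  have hsq : ((√τ : ℝ) : ℂ) ^ 2 = τ := by
    rw [← Complex.ofReal_pow, Real.sq_sqrt hτ.le]
  have hroot : (b ^ 2) ^ (1 / 2 : ℂ) = b := by
    rw [one_div, Complex.sq_cpow_two_inv hb]
  have hroot' : (b ^ 2 * τ) ^ (1 / 2 : ℂ) = b * (√τ : ℝ) := by
    rw [← hsq, ← mul_pow, one_div, Complex.sq_cpow_two_inv]
    simpa using mul_pos hb hx
  have hsym : ∫ t : ℝ, cexp (-(τ : ℂ) * (t : ℂ) ^ 2) / (b ^ 2 + (t : ℂ) ^ 2) =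
      (1 / b) * ∫ t : ℝ, cexp (-(τ : ℂ) * (t : ℂ) ^ 2) / (b - I * t) := by
    have h := integrable_gaussian_div_sub hb hτ
    simp only [gaussian_div_sq_add_sq hb]
    rw [integral_const_mul]
    refine (congrArg _ (integral_add_comp_neg h)).trans ?_
    rw [← mul_assoc]
    congr 1
    field_simp
  have hpi : (Real.pi / τ : ℂ) ^ (1 / 2 : ℂ) = ((√Real.pi / √τ : ℝ) : ℂ) := by
    rw [← Complex.ofReal_div, ← Real.sqrt_div Real.pi_pos.le, Real.sqrt_eq_rpow,
      Complex.ofReal_cpow (by positivity)]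
    norm_num
  have hsub : ∫ s : ℝ in Set.Ioi 0, cexp (-b * s) * cexp (-(s : ℂ) ^ 2 / (4 * τ)) =
      (2 * √τ : ℝ) * ∫ s : ℝ in Set.Ioi 0,
        cexp (b ^ 2 * τ) * cexp (-(b * (√τ : ℝ) + s) ^ 2) := by
    have h := integral_comp_mul_left_Ioi
      (fun s : ℝ => cexp (-b * s) * cexp (-(s : ℂ) ^ 2 / (4 * τ))) 0
      (show 0 < 2 * √τ by positivity)
    rw [mul_zero] at h
    have h' : ∀ s : ℝ, cexp (-b * (2 * √τ * s : ℝ)) *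
        cexp (-((2 * √τ * s : ℝ) : ℂ) ^ 2 / (4 * τ)) =
        cexp (b ^ 2 * τ) * cexp (-(b * (√τ : ℝ) + s) ^ 2) := by
      intro s
      rw [← Complex.exp_add, ← Complex.exp_add, ← hsq]
      congr 1
      have : ((√τ : ℝ) : ℂ) ≠ 0 := by exact_mod_cast hx.ne'
      push_cast
      field_simp
      ring
    simp only [h'] at h
    rw [h, Complex.real_smul, ← mul_assoc, ← Complex.ofReal_mul, mul_inv_cancel₀ (by positivity)]
    simp
  rw [hsym, integral_gaussian_div_sub hb hτ, hpi, hsub, hroot, hroot', cerfc, integral_const_mul]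
  have hx' : ((√τ : ℝ) : ℂ) ≠ 0 := by exact_mod_cast hx.ne'
  have hp : ((√Real.pi : ℝ) : ℂ) ≠ 0 := by
    exact_mod_cast (Real.sqrt_pos.2 Real.pi_pos).ne'
  have hp2 : ((√Real.pi : ℝ) : ℂ) ^ 2 = (Real.pi : ℂ) := by
    rw [← Complex.ofReal_pow, Real.sq_sqrt Real.pi_pos.le]
  rw [← hp2]
  push_cast
  field_simp

theorem hasDerivAt_integral_gaussian_mul {g : ℝ → ℝ} (hg : Continuous g) {C : ℝ}
    (hC : ∀ t, |g t| ≤ C) {τ : ℝ} (hτ : 0 < τ) :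
    Integrable (fun t : ℝ => t ^ 2 * Real.exp (-τ * t ^ 2) * g t) ∧
    HasDerivAt (fun y : ℝ => ∫ t : ℝ, Real.exp (-y * t ^ 2) * g t)
      (-∫ t : ℝ, t ^ 2 * Real.exp (-τ * t ^ 2) * g t) τ := by
  have hint : ∀ c : ℝ, 0 < c → Integrable (fun t : ℝ => t ^ 2 * Real.exp (-c * t ^ 2)) := by
    intro c hc
    simpa using integrable_rpow_mul_exp_neg_mul_sq hc (s := 2) (by norm_num)
  have key := hasDerivAt_integral_of_dominated_loc_of_deriv_le (𝕜 := ℝ) (μ := volume)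
    (F := fun y t : ℝ => Real.exp (-y * t ^ 2) * g t)
    (F' := fun y t : ℝ => -(t ^ 2 * Real.exp (-y * t ^ 2) * g t))
    (bound := fun t => t ^ 2 * Real.exp (-(τ / 2) * t ^ 2) * C)
    (x₀ := τ) (s := Set.Ioi (τ / 2)) (Ioi_mem_nhds (by linarith))
    (Filter.Eventually.of_forall fun y => (by fun_prop : Continuous _).aestronglyMeasurable)
    ((integrable_exp_neg_mul_sq hτ).mul_bdd (c := C) hg.aestronglyMeasurable (ae_of_all _ hC))
    (by fun_prop : Continuous _).aestronglyMeasurable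
    (ae_of_all _ fun t y hy => ?_)
    ((hint _ (half_pos hτ)).mul_const C)
    (ae_of_all _ fun t y hy => ?_)
  · refine ⟨by simpa using key.1.neg, ?_⟩
    simpa [integral_neg] using key.2
  · have hy' : τ / 2 < y := hy
    have h1 : Real.exp (-y * t ^ 2) ≤ Real.exp (-(τ / 2) * t ^ 2) :=
      Real.exp_le_exp.2 (by nlinarith [sq_nonneg t])
    rw [norm_neg, norm_mul, norm_mul, Real.norm_of_nonneg (sq_nonneg t),
      Real.norm_of_nonneg (Real.exp_pos _).le, Real.norm_eq_abs]
    gcongr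
    exact hC t
  · have h := ((((hasDerivAt_id y).neg).mul_const (t ^ 2)).exp).mul_const (g t)
    refine h.congr_deriv ?_
    simp only [Pi.neg_apply, id]
    ring

/-- For `κ ∈ (0,4)`, with `α = e^{iθ}`, `θ ∈ (0,π)`, the root of `m² + (2-κ)m + 1`
with positive imaginary part and `β = conj α`, the solution
`u(τ) = 1 + (√κ/(α-β)) [e^{ατ}erfc(√(ατ))/√α - e^{βτ}erfc(√(βτ))/√β]`
is real-valued on `[0,∞)` and has positive (real) derivative for all `τ > 0`. -/
theorem stmt_9 (κ θ : ℝ) (hκ : κ ∈ Set.Ioo (0:ℝ) 4) (hθ : θ ∈ Set.Ioo 0 Real.pi)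
    (α β : ℂ) (hαθ : α = Complex.exp (θ * Complex.I))
    (hα : α ^ 2 + (2 - (κ:ℂ)) * α + 1 = 0) (hβ : β = starRingEnd ℂ α)
    (u : ℝ → ℂ)
    (hu : ∀ τ : ℝ, u τ = 1 + ((Real.sqrt κ : ℂ) / (α - β)) *
      (Complex.exp (α * τ) * cerfc ((α * τ) ^ (1/2 : ℂ)) / α ^ (1/2 : ℂ)
        - Complex.exp (β * τ) * cerfc ((β * τ) ^ (1/2 : ℂ)) / β ^ (1/2 : ℂ))) :
    (∀ τ : ℝ, 0 ≤ τ → (u τ).im = 0) ∧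
    (∀ τ : ℝ, 0 < τ → ∃ d : ℂ, HasDerivAt u d τ ∧ d.im = 0 ∧ 0 < d.re) := by
  obtain ⟨hθ0, hθπ⟩ := hθ
  have hs : 0 < Real.sin θ := Real.sin_pos_of_pos_of_lt_pi hθ0 hθπ
  set a : ℂ := cexp ((θ / 2 : ℝ) * I) with ha
  have hare : 0 < a.re := by
    rw [ha, Complex.exp_ofReal_mul_I_re]
    exact Real.cos_pos_of_mem_Ioo ⟨by linarith, by linarith⟩
  have haα : α = a ^ 2 := by
    rw [hαθ, ha, ← Complex.exp_nat_mul]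
    push_cast
    ring_nf
  set b : ℂ := starRingEnd ℂ a with hb
  have hbre : 0 < b.re := by simpa [hb] using hare
  have hbβ : β = b ^ 2 := by rw [hβ, haα, map_pow]
  have hαre : α.re = Real.cos θ := by rw [hαθ, Complex.exp_ofReal_mul_I_re]
  have hαim : α.im = Real.sin θ := by rw [hαθ, Complex.exp_ofReal_mul_I_im]
  have hαβ : α - β ≠ 0 := fun h => by
    have := congrArg Complex.im h
    simp [hβ, hαim] at this
    linarith
  set q : ℝ → ℝ := fun t => (Real.cos θ + t ^ 2) ^ 2 + Real.sin θ ^ 2 with hq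
  have hqs : ∀ t, Real.sin θ ^ 2 ≤ q t := fun t => by
    simp only [hq]
    nlinarith [sq_nonneg (Real.cos θ + t ^ 2)]
  have hq0 : ∀ t, 0 < q t := fun t => (pow_pos hs 2).trans_le (hqs t)
  have hprod : ∀ t : ℝ, (a ^ 2 + (t : ℂ) ^ 2) * (b ^ 2 + (t : ℂ) ^ 2) = (q t : ℂ) := by
    intro t
    rw [← haα, ← hbβ, hβ]
    apply Complex.ext
    · rw [Complex.ofReal_re]
      simp [hq, hαre, hαim, pow_two]
    · rw [Complex.ofReal_im]
      simp [hαre, hαim, pow_two]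
      ring
  set V : ℝ → ℝ := fun τ => 1 - √κ / Real.pi * ∫ t : ℝ, Real.exp (-τ * t ^ 2) * (q t)⁻¹ with hV
  have huV : ∀ τ : ℝ, 0 < τ → u τ = (V τ : ℂ) := by
    intro τ hτ
    rw [hu, hbβ, haα, exp_mul_cerfc_div hare hτ, exp_mul_cerfc_div hbre hτ, ← mul_sub,
      ← integral_sub (integrable_gaussian_div_sq_add_sq hare hτ)
        (integrable_gaussian_div_sq_add_sq hbre hτ)]
    have hpt : ∀ t : ℝ, cexp (-(τ : ℂ) * (t : ℂ) ^ 2) / (a ^ 2 + (t : ℂ) ^ 2) -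
        cexp (-(τ : ℂ) * (t : ℂ) ^ 2) / (b ^ 2 + (t : ℂ) ^ 2) =
        (-(a ^ 2 - b ^ 2)) * ((Real.exp (-τ * t ^ 2) * (q t)⁻¹ : ℝ) : ℂ) := by
      intro t
      have h1 := add_sq_ne_zero_of_re_pos hare t
      have h2 := add_sq_ne_zero_of_re_pos hbre t
      push_cast
      rw [← hprod]
      field_simp
      ring
    simp only [hpt]
    rw [integral_const_mul, integral_complex_ofReal, hV]
    rw [haα, hbβ] at hαβ
    push_cast
    field_simp
    ring
  constructor
  · intro τ hτ
    rcases hτ.eq_or_lt with rfl | hτ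
    · have hc : ∃ c : ℝ, cerfc 0 = c := by
        refine ⟨2 / √Real.pi * ∫ s : ℝ in Set.Ioi (0 : ℝ), Real.exp (-(0 + s) ^ 2), ?_⟩
        rw [cerfc, Complex.ofReal_mul, ← integral_complex_ofReal]
        push_cast
        rfl
      obtain ⟨c, hc⟩ := hc
      have hne : (1 / 2 : ℂ) ≠ 0 := by norm_num
      have ha0 : a ≠ 0 := Complex.exp_ne_zero _
      have hb0 : b ≠ 0 := by simpa [hb] using ha0
      have hab : a - b ≠ 0 := fun h => hαβ (by rw [haα, hbβ, sq_sub_sq, h, mul_zero])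
      have hab' : a + b ≠ 0 := fun h => hαβ (by rw [haα, hbβ, sq_sub_sq, h, zero_mul])
      have h1 : a * b = ((Complex.normSq a : ℝ) : ℂ) := Complex.mul_conj a
      have h2 : a + b = ((2 * a.re : ℝ) : ℂ) := Complex.add_conj a
      have h3 : u 0 = ((1 - √κ * c / (Complex.normSq a * (2 * a.re)) : ℝ) : ℂ) := by
        rw [hu, haα, hbβ]
        simp only [Complex.ofReal_zero, mul_zero, Complex.exp_zero, Complex.zero_cpow hne, hc]
        rw [one_div, Complex.sq_cpow_two_inv hare, Complex.sq_cpow_two_inv hbre]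
        rw [Complex.ofReal_sub, Complex.ofReal_div, Complex.ofReal_mul, Complex.ofReal_mul,
          ← h1, ← h2, sq_sub_sq]
        push_cast
        field_simp
        ring
      rw [h3, Complex.ofReal_im]
    · rw [huV τ hτ, Complex.ofReal_im]
  · intro τ hτ
    have hqc : Continuous fun t => (q t)⁻¹ :=
      Continuous.inv₀ (by fun_prop) fun t => (hq0 t).ne'
    obtain ⟨hint, hder⟩ := hasDerivAt_integral_gaussian_mul hqc (C := (Real.sin θ ^ 2)⁻¹)
      (fun t => by
        rw [abs_of_pos (inv_pos.2 (hq0 t))]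
        exact inv_anti₀ (pow_pos hs 2) (hqs t)) hτ
    have hpos : 0 < ∫ t : ℝ, t ^ 2 * Real.exp (-τ * t ^ 2) * (q t)⁻¹ := by
      have hnn : ∀ t : ℝ, 0 ≤ t ^ 2 * Real.exp (-τ * t ^ 2) * (q t)⁻¹ := fun t => by
        have := hq0 t
        positivity
      refine integral_pos_of_integrable_nonneg_nonzero (x := 1) (by fun_prop) hint hnn ?_
      have := hq0 1
      positivity
    refine ⟨((√κ / Real.pi * ∫ t : ℝ, t ^ 2 * Real.exp (-τ * t ^ 2) * (q t)⁻¹ : ℝ) : ℂ),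
      ?_, Complex.ofReal_im _, ?_⟩
    · have hVd : HasDerivAt V
          (√κ / Real.pi * ∫ t : ℝ, t ^ 2 * Real.exp (-τ * t ^ 2) * (q t)⁻¹) τ := by
        have := (hder.const_mul (√κ / Real.pi)).const_sub 1
        simpa [hV] using this
      refine hVd.ofReal_comp.congr_of_eventuallyEq ?_
      filter_upwards [Ioi_mem_nhds hτ] with y hy using huV y hy
    · rw [Complex.ofReal_re]
      have := Real.sqrt_pos.2 hκ.1
      have := Real.pi_pos
      positivity
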